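/- Let G be a finite simple graph, s ≥ 2 an integer, and ε > 0 a real number. Then there exists t₀ (depending on G, s and ε) such that for every integer t ≥ t₀ one has gn(G,t) ≥ gn(G,s) − ε. -/

import Mathlib

/-- A guessing strategy on graph `G` with alphabet `A`: each player `v` maps the
values of its neighbours to a guess of its own value. -/
def GuessStrategy {V : Type*} (G : SimpleGraph V) (A : Type*) : Type _ :=
  ∀ v : V, ((G.neighborSet v) → A) → A

/-- An assignment `a : V → A` is winning for the strategy `F` if every player
guesses its own value correctly. -/
def WinningAssignment {V : Type*} {G : SimpleGraph V} {A : Type*}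
    (F : GuessStrategy G A) (a : V → A) : Prop :=
  ∀ v : V, F v (fun u => a u.1) = a v

/-- The number of assignments won by strategy `F` in the game `(G, s)`. -/
noncomputable def winCount {V : Type*} (G : SimpleGraph V) (s : ℕ)
    (F : GuessStrategy G (Fin s)) : ℕ :=
  Nat.card {a : V → Fin s // WinningAssignment F a}

/-- `N(G,s)`: the maximum number of winning assignments over all strategies. -/
noncomputable def maxWinCount {V : Type*} (G : SimpleGraph V) (s : ℕ) : ℕ :=
  sSup {n | ∃ F : GuessStrategy G (Fin s), winCount G s F = n}

/-- The guessing number `gn(G,s) = log_s N(G,s)`. -/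
noncomputable def gn {V : Type*} (G : SimpleGraph V) (s : ℕ) : ℝ :=
  Real.logb s (maxWinCount G s)

/-- The `t`-uniform blowup of `G`. -/
def blowup {V : Type*} (G : SimpleGraph V) (t : ℕ) : SimpleGraph (V × Fin t) :=
  G.comap Prod.fst

lemma bddAbove_winCount {V : Type*} [Finite V] (G : SimpleGraph V) (s : ℕ) :
    BddAbove {n | ∃ F : GuessStrategy G (Fin s), winCount G s F = n} := by
  refine ⟨Nat.card (V → Fin s), ?_⟩
  rintro _ ⟨F, rfl⟩
  exact Finite.card_subtype_le _

lemma winCount_le_maxWinCount {V : Type*} [Finite V] (G : SimpleGraph V) (s : ℕ)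
    (F : GuessStrategy G (Fin s)) : winCount G s F ≤ maxWinCount G s :=
  le_csSup (bddAbove_winCount G s) ⟨F, rfl⟩

lemma exists_winCount_eq_maxWinCount {V : Type*} [Finite V] (G : SimpleGraph V) {s : ℕ}
    (hs : 0 < s) : ∃ F : GuessStrategy G (Fin s), winCount G s F = maxWinCount G s :=
  Nat.sSup_mem (s := {n | ∃ F : GuessStrategy G (Fin s), winCount G s F = n})
    ⟨_, fun _ _ => ⟨0, hs⟩, rfl⟩ (bddAbove_winCount G s)

lemma maxWinCount_pos {V : Type*} [Finite V] (G : SimpleGraph V) {s : ℕ} (hs : 0 < s) :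
    0 < maxWinCount G s := by
  let F : GuessStrategy G (Fin s) := fun _ _ => ⟨0, hs⟩
  have : Nonempty {a : V → Fin s // WinningAssignment F a} := ⟨fun _ => ⟨0, hs⟩, fun _ => rfl⟩
  exact Nat.card_pos.trans_le (winCount_le_maxWinCount G s F)

/-- Playing `k` independent copies of an optimal strategy, encoded in the larger alphabet. -/
lemma maxWinCount_pow_le {V : Type*} [Finite V] (G : SimpleGraph V) {s t k : ℕ}
    (hs : 0 < s) (h : s ^ k ≤ t) : maxWinCount G s ^ k ≤ maxWinCount G t := by
  obtain ⟨F, hF⟩ := exists_winCount_eq_maxWinCount G hs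
  have : Nonempty (Fin s) := ⟨⟨0, hs⟩⟩
  obtain ⟨c⟩ : Nonempty ((Fin k → Fin s) ↪ Fin t) :=
    Function.Embedding.nonempty_of_card_le (by simpa using h)
  have hc : ∀ x, Function.invFun c (c x) = x := Function.leftInverse_invFun c.injective
  let F' : GuessStrategy G (Fin t) := fun v x =>
    c fun i => F v fun u => Function.invFun c (x u) i
  let e : (Fin k → {a : V → Fin s // WinningAssignment F a}) →
      {a : V → Fin t // WinningAssignment F' a} := fun b =>
    ⟨fun v => c fun i => (b i).1 v, fun v => by
      simp only [F', hc]
      exact congrArg c (funext fun i => (b i).2 v)⟩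
  have he : Function.Injective e := fun b b' hb => by
    funext i
    ext1
    funext v
    exact congrFun (c.injective (congrFun (congrArg Subtype.val hb) v)) i
  calc maxWinCount G s ^ k
      = Nat.card (Fin k → {a : V → Fin s // WinningAssignment F a}) := by
        rw [← hF, winCount, Nat.card_fun, Nat.card_fin]
    _ ≤ winCount G t F' := Nat.card_le_card_of_injective e he
    _ ≤ maxWinCount G t := winCount_le_maxWinCount G t F'

/-- For a finite simple graph G, an integer s ≥ 2 and ε > 0, there is
t₀ such that gn(G,t) ≥ gn(G,s) − ε for all integers t ≥ t₀. -/
theorem gn_eventually_ge {V : Type*} [Fintype V] (G : SimpleGraph V)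
    (s : ℕ) (hs : 2 ≤ s) (ε : ℝ) (hε : 0 < ε) :
    ∃ t₀ : ℕ, ∀ t : ℕ, t₀ ≤ t → gn G s - ε ≤ gn G t := by
  have hs0 : 0 < s := by omega
  have hN : (1 : ℝ) ≤ maxWinCount G s := by exact_mod_cast maxWinCount_pos G hs0
  have hlogN : 0 ≤ Real.log (maxWinCount G s) := Real.log_nonneg hN
  obtain ⟨K, hK⟩ := exists_nat_ge (gn G s / ε)
  refine ⟨s ^ (K + 1), fun t ht => ?_⟩
  have ht1 : 1 < t := (Nat.one_lt_pow K.succ_ne_zero hs).trans_le ht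
  have hlogt : 0 < Real.log t := Real.log_pos (by exact_mod_cast ht1)
  obtain ⟨k, hk⟩ : ∃ k, k = Nat.log s t := ⟨_, rfl⟩
  have hkt : s ^ k ≤ t := hk ▸ Nat.pow_log_le_self s (by omega)
  have htk : t < s ^ (k + 1) := hk ▸ Nat.lt_pow_succ_log_self hs t
  have hKk : K ≤ k := by
    have := Nat.le_log_of_pow_le hs ht
    omega
  have hlogt_le : Real.log t ≤ (k + 1) * Real.log s := by
    have := Real.log_le_log (by positivity) (Nat.cast_le (α := ℝ).2 htk.le)
    simpa using this
  have hlogN_le : k * Real.log (maxWinCount G s) ≤ Real.log (maxWinCount G t) := by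
    rw [← Real.log_pow]
    exact Real.log_le_log (by positivity) (by exact_mod_cast maxWinCount_pow_le G hs0 hkt)
  have hgs : gn G s ≤ (k + 1) * ε := by
    rw [div_le_iff₀ hε] at hK
    have : (K : ℝ) ≤ k + 1 := by exact_mod_cast hKk.trans k.le_succ
    exact hK.trans (by gcongr)
  calc gn G s - ε ≤ k / (k + 1) * gn G s := by
        have hk1 : (0 : ℝ) < k + 1 := by positivity
        rw [div_mul_eq_mul_div, le_div_iff₀ hk1]
        linarith
    _ = k * Real.log (maxWinCount G s) / ((k + 1) * Real.log s) := by
        rw [gn, Real.logb, div_mul_div_comm]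
    _ ≤ k * Real.log (maxWinCount G s) / Real.log t := by gcongr
    _ ≤ Real.log (maxWinCount G t) / Real.log t := by gcongr
    _ = gn G t := rfl
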